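/- arXiv:1301.2828 — 2 statements merged into one kernel-verified Lean document; each statement's English description precedes it below -/
import Mathlib

section
/- Let k be a positive integer, T > 0, and x ≥ 0 be real. Let X be a random variable with E|X|^k < ∞ and characteristic function f(t) := E e^{itX}. Let M : ℝ → ℂ be k times continuously differentiable with M(t) = 0 for |t| > 1, with Re M even and Im M odd, and suppose M satisfies the Prawitz smoothing inequalities: for every random variable Y with characteristic function f_Y, every real T' > 0 and every real y, 𝔊(M(-·/T')·f_Y(·))(y) ≤ P(Y < y) - 1/2 and P(Y ≤ y) - 1/2 ≤ 𝔊(M(·/T')·f_Y(·))(y). Define r_{T,±}(t) := M(∓t/T)·f(t). Then -i^k·𝔊(Λᵏ r_{T,-})(x) ≤ x^k·P(X > x) ≤ x^k·P(X ≥ x) ≤ -i^k·𝔊(Λᵏ r_{T,+})(x). -/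
open MeasureTheory Filter Set
open scoped Real Topology

/-- The integrand `e^{-itx} f(t) / t` of the integral defining `𝔊(f)(x)`. -/
noncomputable def pvI (f : ℝ → ℂ) (x t : ℝ) : ℂ :=
  Complex.exp (-(Complex.I) * t * x) * f t / t

/-- `HasG f x L` means that the principal-value integral defining
`𝔊(f)(x) = (i/(2π)) p.v.∫_{-∞}^∞ e^{-itx} f(t) dt/t` exists and equals `L`, where
`p.v.∫ = lim_{ε↓0, A↑∞} (∫_{-A}^{-ε} + ∫_ε^A)`. -/
def HasG (f : ℝ → ℂ) (x : ℝ) (L : ℂ) : Prop :=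
  Tendsto (fun q : ℝ × ℝ =>
      (Complex.I / (2 * (Real.pi : ℂ))) *
        ((∫ t in (-q.2)..(-q.1), pvI f x t) + ∫ t in q.1..q.2, pvI f x t))
    ((𝓝[>] (0 : ℝ)) ×ˢ atTop) (𝓝 L)

/-- The operator `Λ`: `(Λh)(t) = -(h(0) - [h(t) + h'(t)(-t)])/t` for `t ≠ 0`, `(Λh)(0) = 0`. -/
noncomputable def Lam (h : ℝ → ℂ) (t : ℝ) : ℂ :=
  if t = 0 then 0 else -((h 0 - (h t + deriv h t * (-(t : ℂ)))) / (t : ℂ))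


open scoped ComplexOrder

lemma ctsInt (n : ℕ) : ∀ (a : ℕ) (u : ℝ → ℂ), ContDiff ℝ n u →
    ContDiff ℝ n (fun t : ℝ => ∫ s in (0:ℝ)..1, ((s : ℂ) ^ a) * u (s * t)) := by
  induction n with
  | zero =>
    intro a u hu
    have hc : Continuous u := hu.continuous
    simp only [Nat.cast_zero, contDiff_zero]
    apply intervalIntegral.continuous_parametric_intervalIntegral_of_continuous'
    fun_prop
  | succ n ih =>
    intro a u hu
    have hu' : ContDiff ℝ ((n : WithTop ℕ∞) + 1) u := by exact_mod_cast hu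
    have hd := contDiff_succ_iff_deriv.1 hu'
    have hc : Continuous u := hu.continuous
    have hcd : Continuous (deriv u) := hd.2.2.continuous
    have key : ∀ t : ℝ, HasDerivAt (fun t : ℝ => ∫ s in (0:ℝ)..1, ((s : ℂ) ^ a) * u (s * t))
        (∫ s in (0:ℝ)..1, ((s : ℂ) ^ (a+1)) * deriv u (s * t)) t := by
      intro t
      obtain ⟨C, hC⟩ := (isCompact_closedBall (0:ℝ) (|t| + 1)).exists_bound_of_continuousOn
        hcd.continuousOn
      refine (intervalIntegral.hasDerivAt_integral_of_dominated_loc_of_deriv_le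
        (F := fun (t s : ℝ) => ((s : ℂ) ^ a) * u (s * t))
        (F' := fun (t s : ℝ) => ((s : ℂ) ^ (a+1)) * deriv u (s * t))
        (bound := fun _ => C) (Metric.ball_mem_nhds t one_pos) ?_ ?_ ?_ ?_ ?_ ?_).2
      · filter_upwards with z
        exact Continuous.aestronglyMeasurable (by fun_prop)
      · exact Continuous.intervalIntegrable (by fun_prop) _ _
      · exact Continuous.aestronglyMeasurable (by fun_prop)
      · filter_upwards with s hs z hz
        rw [uIoc_of_le zero_le_one] at hs
        have h1 : |z| ≤ |t| + 1 := by
          rw [Metric.mem_ball, Real.dist_eq] at hz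
          have := abs_sub_abs_le_abs_sub z t
          linarith
        have h2 : |s * z| ≤ |t| + 1 := by
          rw [abs_mul, abs_of_pos hs.1]
          nlinarith [hs.2, hs.1, abs_nonneg z]
        have h3 := hC (s * z) (by simpa using h2)
        rw [norm_mul, norm_pow, Complex.norm_real, Real.norm_of_nonneg hs.1.le]
        have h4 : s ^ (a+1) ≤ 1 := pow_le_one₀ hs.1.le hs.2
        have := norm_nonneg (deriv u (s * z))
        nlinarith
      · exact intervalIntegrable_const
      · filter_upwards with s hs z hz
        have h1 : HasDerivAt (fun z : ℝ => u (s * z)) ((s * 1 : ℝ) • deriv u (s * z)) z :=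
          (hd.1 (s * z)).hasDerivAt.scomp z ((hasDerivAt_id z).const_mul s)
        have h2 := h1.const_mul ((s:ℂ)^a)
        refine h2.congr_deriv ?_
        rw [Complex.real_smul]; push_cast; ring
    have : ContDiff ℝ ((n : WithTop ℕ∞) + 1)
        (fun t : ℝ => ∫ s in (0:ℝ)..1, ((s : ℂ) ^ a) * u (s * t)) := by
      rw [contDiff_succ_iff_deriv]
      refine ⟨fun t => (key t).differentiableAt, by simp, ?_⟩
      rw [funext fun t => (key t).deriv]
      exact ih (a+1) _ hd.2.2
    exact_mod_cast this

lemma Lam_eq (h : ℝ → ℂ) (hh : ContDiff ℝ 1 h) (t : ℝ) :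
    Lam h t = (∫ s in (0:ℝ)..1, ((s : ℂ) ^ 0) * deriv h (s * t)) - deriv h t := by
  have hcd : Continuous (deriv h) := hh.continuous_deriv le_rfl
  have hdi : Differentiable ℝ h := hh.differentiable one_ne_zero
  unfold Lam
  split_ifs with ht
  · simp [ht]
  · have ht' : (t : ℂ) ≠ 0 := by exact_mod_cast ht
    have h1 : (∫ s in (0:ℝ)..1, t • deriv h (s * t)) = h (1 * t) - h (0 * t) := by
      apply intervalIntegral.integral_eq_sub_of_hasDerivAt (f := fun s => h (s * t))
      · intro s _
        have := (hdi (s * t)).hasDerivAt.scomp s ((hasDerivAt_id s).mul_const t)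
        refine HasDerivAt.congr_deriv (f := fun s => h (s * t)) this ?_
        simp
      · exact Continuous.intervalIntegrable (by fun_prop) _ _
    rw [intervalIntegral.integral_smul] at h1
    simp only [one_mul, zero_mul, Complex.real_smul] at h1
    simp only [pow_zero, one_mul]
    field_simp
    linear_combination -h1

lemma Lam_contDiff (n : ℕ) (h : ℝ → ℂ) (hh : ContDiff ℝ (n + 1 : ℕ) h) :
    ContDiff ℝ n (Lam h) := by
  have hu' : ContDiff ℝ ((n : WithTop ℕ∞) + 1) h := by exact_mod_cast hh
  have hd := (contDiff_succ_iff_deriv.1 hu').2.2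
  have h1 : ContDiff ℝ 1 h := hu'.of_le (by simp)
  rw [funext (Lam_eq h h1)]
  exact (ctsInt n 0 _ hd).sub hd

lemma Lam_zero (h : ℝ → ℂ) : Lam h 0 = 0 := by simp [Lam]

def Tl (h : ℝ → ℂ) : Prop :=
  ∃ p : Polynomial ℂ, ∃ R : ℝ, 0 < R ∧ ∀ t : ℝ, R < |t| → h t = p.eval ((t : ℂ)⁻¹)

lemma Lam_Tl (h : ℝ → ℂ) (hh : Tl h) : Tl (Lam h) := by
  obtain ⟨p, R, hR, hp⟩ := hh
  refine ⟨(p - Polynomial.C (h 0)) * Polynomial.X + Polynomial.derivative p * Polynomial.X ^ 2,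
    R, hR, fun t ht => ?_⟩
  have ht0 : t ≠ 0 := by
    rintro rfl
    simp at ht; linarith
  have htc : (t : ℂ) ≠ 0 := by exact_mod_cast ht0
  have hev : h =ᶠ[𝓝 t] fun s : ℝ => p.eval ((s : ℂ)⁻¹) := by
    have : {s : ℝ | R < |s|} ∈ 𝓝 t := (isOpen_lt continuous_const continuous_abs).mem_nhds ht
    filter_upwards [this] with s hs using hp s hs
  have h1 : HasDerivAt (fun s : ℝ => ((s : ℂ)⁻¹)) (-((t:ℂ)^2)⁻¹) t :=
    (hasDerivAt_inv htc).comp_ofReal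
  have h2 : HasDerivAt (fun s : ℝ => p.eval ((s : ℂ)⁻¹))
      ((Polynomial.derivative p).eval ((t:ℂ)⁻¹) * (-((t:ℂ)^2)⁻¹)) t :=
    (p.hasDerivAt _).comp t h1
  have h3 := hev.deriv_eq.trans h2.deriv
  simp only [Lam, ht0, if_false, h3, hp t ht, Polynomial.eval_add, Polynomial.eval_mul,
    Polynomial.eval_sub, Polynomial.eval_pow, Polynomial.eval_X, Polynomial.eval_C]
  field_simp
  ring

lemma Tl_tendsto (h : ℝ → ℂ) (hh : Tl h) (l : Filter ℝ) (hl : Tendsto (fun t => |t|) l atTop)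
    (c : ℂ) : Tendsto (fun t : ℝ => (h t - c) / t) l (𝓝 0) := by
  obtain ⟨p, R, hR, hp⟩ := hh
  have h0 : Tendsto (fun t : ℝ => ((t : ℂ)⁻¹)) l (𝓝 0) := by
    rw [tendsto_zero_iff_norm_tendsto_zero]
    simp only [norm_inv, Complex.norm_real, Real.norm_eq_abs]
    exact tendsto_inv_atTop_zero.comp hl
  have h1 : Tendsto (fun t : ℝ => (p.eval ((t : ℂ)⁻¹) - c) * (t:ℂ)⁻¹) l
      (𝓝 ((p.eval 0 - c) * 0)) :=
    ((((p.continuous).tendsto 0).comp h0).sub_const c).mul h0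
  rw [mul_zero] at h1
  refine h1.congr' ?_
  filter_upwards [hl.eventually_gt_atTop R] with t ht
  rw [hp t ht, div_eq_mul_inv]

lemma E_deriv (x t : ℝ) : HasDerivAt (fun t : ℝ => Complex.exp (-(Complex.I) * t * x))
    (Complex.exp (-(Complex.I) * t * x) * (-(Complex.I) * x)) t := by
  have h1 : HasDerivAt (fun t : ℝ => -(Complex.I) * (t:ℂ) * x) (-(Complex.I) * 1 * x) t :=
    (((hasDerivAt_id (t:ℂ)).comp_ofReal).const_mul _).mul_const _
  simpa using h1.cexp

lemma pvI_int (h : ℝ → ℂ) (hh : Continuous h) (x a b : ℝ) (h0 : ∀ t ∈ uIcc a b, t ≠ 0) :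
    IntervalIntegrable (pvI h x) volume a b := by
  apply ContinuousOn.intervalIntegrable
  unfold pvI
  apply ContinuousOn.div
  · exact Continuous.continuousOn (by fun_prop)
  · exact Continuous.continuousOn (by fun_prop)
  · intro t ht
    exact_mod_cast h0 t ht

lemma ibp (h : ℝ → ℂ) (hh : ContDiff ℝ 1 h) (x a b : ℝ) (h0 : ∀ t ∈ uIcc a b, t ≠ 0) :
    (∫ t in a..b, pvI (Lam h) x t) =
      -(Complex.exp (-(Complex.I) * b * x) * ((h b - h 0) / b)
        - Complex.exp (-(Complex.I) * a * x) * ((h a - h 0) / a))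
      + (-(Complex.I) * x) * ((∫ t in a..b, pvI h x t) - ∫ t in a..b, pvI (fun _ => h 0) x t) := by
  have hcd : Continuous (deriv h) := hh.continuous_deriv le_rfl
  have hdi : Differentiable ℝ h := hh.differentiable one_ne_zero
  have hc : Continuous h := hh.continuous
  have i1 := pvI_int h hc x a b h0
  have i2 := pvI_int (fun _ => h 0) continuous_const x a b h0
  have hL : Continuous (Lam h) := (Lam_contDiff 0 h (by exact_mod_cast hh)).continuous
  have i3 := pvI_int (Lam h) hL x a b h0
  have key : (∫ t in a..b, (-(Complex.I) * x) * (pvI h x t - pvI (fun _ => h 0) x t)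
      - pvI (Lam h) x t) = Complex.exp (-(Complex.I) * b * x) * ((h b - h 0) / b)
        - Complex.exp (-(Complex.I) * a * x) * ((h a - h 0) / a) := by
    apply intervalIntegral.integral_eq_sub_of_hasDerivAt
      (f := fun t : ℝ => Complex.exp (-(Complex.I) * t * x) * ((h t - h 0) / t))
    · intro t ht
      have ht0 : t ≠ 0 := h0 t ht
      have htc : (t:ℂ) ≠ 0 := by exact_mod_cast ht0
      have h1 : HasDerivAt (fun t : ℝ => (h t - h 0) / (t:ℂ))
          ((deriv h t * t - (h t - h 0) * 1) / (t:ℂ)^2) t :=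
        ((hdi t).hasDerivAt.sub_const (h 0)).div ((hasDerivAt_id (t:ℂ)).comp_ofReal) htc
      refine ((E_deriv x t).mul h1).congr_deriv ?_
      simp only [pvI, Lam, ht0, if_false]
      field_simp
      ring
    · exact ((i1.sub i2).const_mul _).sub i3
  rw [intervalIntegral.integral_sub ((i1.sub i2).const_mul _) i3,
    intervalIntegral.integral_const_mul, intervalIntegral.integral_sub i1 i2] at key
  linear_combination -key

lemma ev_pos : ∀ᶠ q : ℝ × ℝ in (𝓝[>] (0 : ℝ)) ×ˢ atTop, 0 < q.1 ∧ q.1 < 1 ∧ 1 < q.2 := by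
  have h1 : ∀ᶠ e : ℝ in 𝓝[>] (0:ℝ), 0 < e ∧ e < 1 :=
    Ioo_mem_nhdsGT one_pos
  have := h1.prod_mk (eventually_gt_atTop (1:ℝ))
  filter_upwards [this] with q hq using ⟨hq.1.1, hq.1.2, hq.2⟩

lemma slope_tendsto (h : ℝ → ℂ) (hh : Differentiable ℝ h) :
    Tendsto (fun t : ℝ => (h t - h 0) / t) (𝓝[≠] 0) (𝓝 (deriv h 0)) := by
  have := hasDerivAt_iff_tendsto_slope.1 (hh 0).hasDerivAt
  refine this.congr fun t => ?_
  simp [slope, div_eq_inv_mul]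

lemma E_norm (x t : ℝ) : ‖Complex.exp (-(Complex.I) * t * x)‖ = 1 := by
  rw [show -(Complex.I) * (t:ℂ) * x = ((-(t * x) : ℝ) : ℂ) * Complex.I by push_cast; ring]
  exact Complex.norm_exp_ofReal_mul_I _

lemma nz_pos {a b : ℝ} (ha : 0 < a) (hb : 0 < b) : ∀ t ∈ uIcc a b, t ≠ 0 := by
  intro t ht
  intro h0
  subst h0
  rcases mem_uIcc.1 ht with h | h <;> linarith [h.1]

lemma step (h : ℝ → ℂ) (hh : ContDiff ℝ 1 h) (ht : Tl h) (x : ℝ) (L D : ℂ)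
    (hL : HasG h x L) (hD : HasG (fun _ => h 0) x D) :
    HasG (Lam h) x (-(Complex.I) * x * (L - D)) := by
  have hdi : Differentiable ℝ h := hh.differentiable one_ne_zero
  have hc := ((hL.sub hD).const_mul (-(Complex.I) * x))
  set E : ℝ → ℂ := fun t => Complex.exp (-(Complex.I) * t * x) with hE
  set g : ℝ → ℂ := fun t => (h t - h 0) / t with hg
  have hEc : Continuous E := by simp only [hE]; fun_prop
  have b1 : Tendsto (fun t => E t * g t) (𝓝[≠] 0) (𝓝 (E 0 * deriv h 0)) :=
    ((hEc.tendsto 0).mono_left nhdsWithin_le_nhds).mul (slope_tendsto h hdi)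
  have b1p : Tendsto (fun q : ℝ × ℝ => E q.1 * g q.1) ((𝓝[>] (0 : ℝ)) ×ˢ atTop)
      (𝓝 (E 0 * deriv h 0)) :=
    (b1.mono_left (nhdsWithin_mono 0 (fun t ht => ne_of_gt ht))).comp tendsto_fst
  have tneg : Tendsto (fun t : ℝ => -t) (𝓝[>] 0) (𝓝[≠] 0) := by
    apply tendsto_nhdsWithin_of_tendsto_nhds_of_eventually_within
    · have : Tendsto (fun t : ℝ => -t) (𝓝 0) (𝓝 (-0)) := continuous_neg.tendsto 0
      rw [neg_zero] at this
      exact this.mono_left nhdsWithin_le_nhds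
    · filter_upwards [self_mem_nhdsWithin] with t ht
      have : (0:ℝ) < t := ht
      simp [this.ne']
  have b1m : Tendsto (fun q : ℝ × ℝ => E (-q.1) * g (-q.1)) ((𝓝[>] (0 : ℝ)) ×ˢ atTop)
      (𝓝 (E 0 * deriv h 0)) := (b1.comp tneg).comp tendsto_fst
  have inf : ∀ l : Filter ℝ, Tendsto (fun t => |t|) l atTop →
      Tendsto (fun t => E t * g t) l (𝓝 0) := by
    intro l hl
    have := Tl_tendsto h ht l hl (h 0)
    rw [tendsto_zero_iff_norm_tendsto_zero] at this ⊢
    refine this.congr fun t => ?_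
    rw [norm_mul, E_norm, one_mul]
  have b2p : Tendsto (fun q : ℝ × ℝ => E q.2 * g q.2) ((𝓝[>] (0 : ℝ)) ×ˢ atTop) (𝓝 0) :=
    (inf atTop tendsto_abs_atTop_atTop).comp tendsto_snd
  have b2m : Tendsto (fun q : ℝ × ℝ => E (-q.2) * g (-q.2)) ((𝓝[>] (0 : ℝ)) ×ˢ atTop) (𝓝 0) :=
    ((inf atBot tendsto_abs_atBot_atTop).comp tendsto_neg_atTop_atBot).comp tendsto_snd
  have bd := (((b1p.sub b1m).sub b2p).add b2m).const_mul (Complex.I / (2 * (Real.pi : ℂ)))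
  have tot := hc.add bd
  unfold HasG
  rw [show -(Complex.I) * x * (L - D) = -Complex.I * ↑x * (L - D) +
    Complex.I / (2 * ↑π) * (E 0 * deriv h 0 - E 0 * deriv h 0 - 0 + 0) by ring]
  refine tot.congr' ?_
  filter_upwards [ev_pos] with q hq
  have n1 := nz_pos hq.1 (zero_lt_one.trans hq.2.2)
  have n2 : ∀ t ∈ uIcc (-q.2) (-q.1), t ≠ 0 := by
    intro t ht
    rw [uIcc_of_le (by linarith)] at ht
    intro h0; subst h0; linarith [ht.2]
  rw [ibp h hh x _ _ n1, ibp h hh x _ _ n2]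
  simp only [hE, hg]
  push_cast
  ring

noncomputable def Si (b : ℝ) : ℝ := ∫ s in (0:ℝ)..b, Real.sinc s

lemma Si_cont : Continuous Si :=
  intervalIntegral.continuous_primitive (fun a b => Real.continuous_sinc.intervalIntegrable a b) 0

lemma Si_zero : Si 0 = 0 := by simp [Si]

lemma const_pv (c : ℂ) (x e A : ℝ) (he : 0 < e) (hA : 0 < A) :
    Complex.I / (2 * (Real.pi : ℂ)) * ((∫ t in (-A)..(-e), pvI (fun _ => c) x t) +
      ∫ t in e..A, pvI (fun _ => c) x t) = c * (((Si (x * A) - Si (x * e)) / π : ℝ) : ℂ) := by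
  have n1 := nz_pos he hA
  have i1 := pvI_int (fun _ => c) continuous_const x e A n1
  have n2 : ∀ t ∈ uIcc (-e) (-A), t ≠ 0 := by
    intro t ht h0
    subst h0
    rcases mem_uIcc.1 ht with h | h <;> linarith [h.2]
  have i2 := pvI_int (fun _ => c) continuous_const x (-e) (-A) n2
  have i3 : IntervalIntegrable (fun t => pvI (fun _ => c) x (-t)) volume e A := by
    simpa using ((IntervalIntegrable.iff_comp_neg (by finiteness)).1 i2)
  have hsi : ((Si (x * A) - Si (x * e) : ℝ) : ℂ) = ∫ t in e..A, (x : ℂ) * (Real.sinc (x * t) : ℂ) := by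
    rw [Si, Si, intervalIntegral.integral_interval_sub_left
      (Real.continuous_sinc.intervalIntegrable _ _) (Real.continuous_sinc.intervalIntegrable _ _),
      ← intervalIntegral.mul_integral_comp_mul_left, ← intervalIntegral.integral_const_mul,
      ← intervalIntegral.integral_ofReal]
    push_cast
    rfl
  rw [← intervalIntegral.integral_comp_neg, ← intervalIntegral.integral_add i3 i1]
  have : (∫ t in e..A, pvI (fun _ => c) x (-t) + pvI (fun _ => c) x t) =
      ∫ t in e..A, (c * (-2 * Complex.I)) * ((x : ℂ) * (Real.sinc (x * t) : ℂ)) := by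
    apply intervalIntegral.integral_congr
    intro t ht
    have ht0 : t ≠ 0 := n1 t ht
    have htc : (t:ℂ) ≠ 0 := by exact_mod_cast ht0
    simp only [pvI]
    rcases eq_or_ne x 0 with rfl | hx
    · simp
      ring
    have hxc : (x:ℂ) ≠ 0 := by exact_mod_cast hx
    rw [Real.sinc_of_ne_zero (mul_ne_zero hx ht0)]
    push_cast
    have e1 : -Complex.I * -(t:ℂ) * x = (x * t) * Complex.I := by ring
    have e2 : -Complex.I * (t:ℂ) * x = (-(x * t)) * Complex.I := by ring
    rw [e1, e2, Complex.exp_mul_I, Complex.exp_mul_I, Complex.cos_neg, Complex.sin_neg]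
    field_simp
    ring
  rw [this, intervalIntegral.integral_const_mul, ← hsi]
  have hpi : (π : ℂ) ≠ 0 := by exact_mod_cast Real.pi_ne_zero
  push_cast
  field_simp
  rw [Complex.I_sq]
  ring

lemma Si_small (x : ℝ) : Tendsto (fun q : ℝ × ℝ => Si (x * q.1)) ((𝓝[>] (0 : ℝ)) ×ˢ atTop) (𝓝 0) := by
  have h : Tendsto (fun e : ℝ => Si (x * e)) (𝓝 0) (𝓝 (Si (x * 0))) :=
    (Si_cont.comp (continuous_const.mul continuous_id)).tendsto 0
  rw [mul_zero, Si_zero] at h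
  exact (h.mono_left nhdsWithin_le_nhds).comp tendsto_fst

lemma HasG_const_zero (c : ℂ) : HasG (fun _ => c) 0 0 := by
  refine tendsto_const_nhds.congr' ?_
  filter_upwards [ev_pos] with q hq
  rw [const_pv c 0 _ _ hq.1 (zero_lt_one.trans hq.2.2)]
  simp

lemma HasG_zero (x : ℝ) : HasG (fun _ => 0) x 0 := by
  refine tendsto_const_nhds.congr fun q => ?_
  simp [pvI]

lemma HasG_const (c : ℝ) (x : ℝ) (hx : 0 < x) (d : ℝ)
    (hS : Tendsto (fun y => c * Si y / π) atTop (𝓝 d)) : HasG (fun _ => (c:ℂ)) x d := by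
  have h1 : Tendsto (fun q : ℝ × ℝ => c * Si (x * q.2) / π) ((𝓝[>] (0 : ℝ)) ×ˢ atTop) (𝓝 d) :=
    (hS.comp (tendsto_id.const_mul_atTop hx)).comp tendsto_snd
  have h2 := h1.sub ((Si_small x).const_mul (c / π))
  rw [mul_zero, sub_zero] at h2
  have h3 := (Complex.continuous_ofReal.tendsto d).comp h2
  refine h3.congr' ?_
  filter_upwards [ev_pos] with q hq
  rw [const_pv c x _ _ hq.1 (zero_lt_one.trans hq.2.2)]
  simp only [Function.comp]
  push_cast
  ring

lemma cpt (h : ℝ → ℂ) (hh : ContDiff ℝ 1 h) (hs : ∀ t, 1 < |t| → h t = 0) (x : ℝ) (G : ℂ)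
    (hG : HasG h x G) :
    G = Complex.I / (2 * (Real.pi : ℂ)) * (∫ t in (-1:ℝ)..1,
      Complex.exp (-(Complex.I) * t * x) * dslope h 0 t) + h 0 * ((Si x / π : ℝ) : ℂ) := by
  have hdi : Differentiable ℝ h := hh.differentiable one_ne_zero
  have hc : Continuous h := hh.continuous
  have hgc : Continuous (dslope h 0) := by
    rw [continuous_iff_continuousAt]
    intro t
    rcases eq_or_ne t 0 with rfl | ht
    · exact continuousAt_dslope_same.2 (hdi 0)
    · exact (continuousAt_dslope_of_ne ht).2 hc.continuousAt
  set F : ℝ → ℂ := fun t => Complex.exp (-(Complex.I) * t * x) * dslope h 0 t with hF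
  have hFc : Continuous F := by simp only [hF]; fun_prop
  have hFi : ∀ a b, IntervalIntegrable F volume a b := fun a b => hFc.intervalIntegrable a b
  refine tendsto_nhds_unique hG ?_
  have hP : Continuous (fun b => ∫ t in (0:ℝ)..b, F t) := intervalIntegral.continuous_primitive hFi 0
  have p1 : Tendsto (fun q : ℝ × ℝ => ∫ t in (0:ℝ)..q.1, F t) ((𝓝[>] (0 : ℝ)) ×ˢ atTop) (𝓝 0) := by
    have := hP.tendsto 0
    rw [intervalIntegral.integral_same] at this
    exact (this.mono_left nhdsWithin_le_nhds).comp tendsto_fst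
  have p2 : Tendsto (fun q : ℝ × ℝ => ∫ t in (0:ℝ)..(-q.1), F t) ((𝓝[>] (0 : ℝ)) ×ˢ atTop) (𝓝 0) := by
    have := (hP.comp continuous_neg).tendsto 0
    simp only [Function.comp, neg_zero, intervalIntegral.integral_same] at this
    exact (this.mono_left nhdsWithin_le_nhds).comp tendsto_fst
  have p3 := (Complex.continuous_ofReal.tendsto 0).comp (Si_small x)
  have tot := (((p2.sub p1).const_add (∫ t in (-1:ℝ)..1, F t)).const_mul
    (Complex.I / (2 * (Real.pi : ℂ)))).add
    (((p3.const_sub (Si x : ℂ)).div_const (π : ℂ)).const_mul (h 0))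
  simp only [sub_zero, add_zero, Complex.ofReal_zero] at tot
  push_cast
  refine tot.congr' ?_
  filter_upwards [ev_pos] with q hq
  obtain ⟨q1, q2, q3⟩ := hq
  have z1 : (∫ t in (1:ℝ)..q.2, pvI h x t) = 0 := by
    rw [intervalIntegral.integral_of_le q3.le]
    apply setIntegral_eq_zero_of_forall_eq_zero
    intro t ht
    simp [pvI, hs t (ht.1.trans_le (le_abs_self t))]
  have z2 : (∫ t in (-q.2)..(-1:ℝ), pvI h x t) = 0 := by
    rw [intervalIntegral.integral_of_le (by linarith), integral_Ioc_eq_integral_Ioo]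
    apply setIntegral_eq_zero_of_forall_eq_zero
    intro t ht
    have : 1 < |t| := by
      rw [lt_abs]; right; linarith [ht.2]
    simp [pvI, hs t this]
  have nn : ∀ a b : ℝ, 0 < a → 0 < b → ∀ t ∈ uIcc (-a) (-b), t ≠ 0 := by
    intro a b ha hb t ht h0
    subst h0
    rcases mem_uIcc.1 ht with h | h <;> linarith [h.2]
  have q20 : 0 < q.2 := by linarith
  rw [← intervalIntegral.integral_add_adjacent_intervals
      (pvI_int h hc x q.1 1 (nz_pos q1 one_pos)) (pvI_int h hc x 1 q.2 (nz_pos one_pos q20)), z1,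
    ← intervalIntegral.integral_add_adjacent_intervals
      (pvI_int h hc x (-q.2) (-1) (nn _ _ q20 one_pos))
      (pvI_int h hc x (-1) (-q.1) (nn _ _ one_pos q1)), z2]
  have cg : ∀ a b : ℝ, (∀ t ∈ uIcc a b, t ≠ 0) → (∫ t in a..b, pvI h x t) =
      (∫ t in a..b, F t) + ∫ t in a..b, pvI (fun _ => h 0) x t := by
    intro a b hab
    rw [← intervalIntegral.integral_add (hFi a b) (pvI_int _ continuous_const x a b hab)]
    apply intervalIntegral.integral_congr
    intro t ht
    have ht0 := hab t ht
    have htc : (t:ℂ) ≠ 0 := by exact_mod_cast ht0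
    simp only [pvI, hF, dslope_of_ne h ht0, slope, vsub_eq_sub, sub_zero, Complex.real_smul]
    push_cast
    field_simp
    ring
  rw [cg _ _ (nz_pos q1 one_pos), cg _ _ (nn _ _ one_pos q1)]
  have k := const_pv (h 0) x q.1 1 q1 one_pos
  rw [mul_one] at k
  have s1 := intervalIntegral.integral_interval_sub_left (hFi 0 (-q.1)) (hFi 0 (-1))
  have s2 := intervalIntegral.integral_interval_sub_left (hFi 0 1) (hFi 0 q.1)
  have s3 := intervalIntegral.integral_interval_sub_left (hFi 0 1) (hFi 0 (-1))
  rw [← s1, ← s2, ← s3]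
  push_cast at k
  simp only [Function.comp]
  linear_combination -k

lemma RL (g : ℝ → ℂ) : Tendsto (fun x : ℝ => ∫ t in (-1:ℝ)..1,
    Complex.exp (-(Complex.I) * t * x) * g t) atTop (𝓝 0) := by
  have h := Real.tendsto_integral_exp_smul_cocompact (indicator (Ioc (-1:ℝ) 1) g)
  have h2 : Tendsto (fun x : ℝ => x / (2 * π)) atTop (cocompact ℝ) :=
    (tendsto_id.atTop_div_const (by positivity)).mono_right atTop_le_cocompact
  refine (h.comp h2).congr fun x => ?_
  rw [intervalIntegral.integral_of_le (by norm_num), ← integral_indicator measurableSet_Ioc]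
  simp only [Function.comp]
  congr 1
  funext t
  by_cases ht : t ∈ Ioc (-1:ℝ) 1
  · simp only [indicator_of_mem ht]
    rw [Circle.smul_def, Real.fourierChar_apply, smul_eq_mul]
    congr 2
    have hpi : (π : ℂ) ≠ 0 := by exact_mod_cast Real.pi_ne_zero
    push_cast
    field_simp
  · simp [indicator_of_notMem ht]

lemma iter0 (x : ℝ) (k : ℕ) : ∀ (h : ℝ → ℂ) (L : ℂ), ContDiff ℝ k h → Tl h → h 0 = 0 →
    HasG h x L → HasG (Lam^[k] h) x ((-(Complex.I) * x) ^ k * L) := by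
  induction k with
  | zero => intro h L _ _ _ hL; simpa using hL
  | succ k ih =>
    intro h L hc ht h0 hL
    rw [Function.iterate_succ_apply]
    have h1 := step h (hc.of_le (by norm_cast; omega)) ht x L 0 hL (by rw [h0]; exact HasG_zero x)
    have h2 := ih (Lam h) _ (Lam_contDiff k h hc) (Lam_Tl h ht) (Lam_zero h) h1
    convert h2 using 1
    ring

lemma iter (x : ℝ) (k : ℕ) (hk : 0 < k) (h : ℝ → ℂ) (L D : ℂ) (hc : ContDiff ℝ k h) (ht : Tl h)
    (hL : HasG h x L) (hD : HasG (fun _ => h 0) x D) :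
    HasG (Lam^[k] h) x ((-(Complex.I) * x) ^ k * (L - D)) := by
  obtain ⟨k, rfl⟩ : ∃ j, k = j + 1 := ⟨k - 1, by omega⟩
  rw [Function.iterate_succ_apply]
  have h1 := step h (hc.of_le (by norm_cast)) ht x L D hL hD
  have h2 := iter0 x k (Lam h) _ (Lam_contDiff k h hc) (Lam_Tl h ht) (Lam_zero h) h1
  convert h2 using 1
  ring

lemma M_Si (M : ℝ → ℂ) (hMC : ContDiff ℝ 1 M)
    (hM0 : ∀ t : ℝ, 1 < |t| → M t = 0) (him : (M 0).im = 0)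
    (hP : ∀ y : ℝ, 0 < y → ∃ Gm Gp : ℂ, HasG (fun t => M (-t)) y Gm ∧ HasG M y Gp ∧
      Gm.re ≤ 1 / 2 ∧ 1 / 2 ≤ Gp.re) :
    Tendsto (fun y => (M 0).re * Si y / π) atTop (𝓝 (1/2)) := by
  set Mm : ℝ → ℂ := fun t => M (-t) with hMm
  have rl : ∀ g : ℝ → ℂ, Tendsto (fun x : ℝ => 1 / 2 - (Complex.I / (2 * (Real.pi : ℂ)) *
      ∫ t in (-1:ℝ)..1, Complex.exp (-(Complex.I) * t * x) * g t).re) atTop (𝓝 (1/2)) := by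
    intro g
    have h1 := (RL g).const_mul (Complex.I / (2 * (Real.pi : ℂ)))
    have h2 := ((Complex.continuous_re.tendsto _).comp h1).const_sub (1/2 : ℝ)
    simpa using h2
  refine tendsto_of_tendsto_of_tendsto_of_le_of_le' (rl (dslope M 0)) (rl (dslope Mm 0)) ?_ ?_
  · filter_upwards [eventually_gt_atTop 0] with y hy
    obtain ⟨Gm, Gp, h1, h2, h3, h4⟩ := hP y hy
    rw [cpt M hMC hM0 y Gp h2, Complex.add_re, Complex.re_mul_ofReal] at h4
    rw [mul_div_assoc]
    linarith
  · filter_upwards [eventually_gt_atTop 0] with y hy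
    obtain ⟨Gm, Gp, h1, h2, h3, h4⟩ := hP y hy
    rw [cpt Mm (hMC.comp contDiff_neg) (fun t ht => hM0 _ (by rwa [abs_neg])) y Gm h1,
      Complex.add_re, Complex.re_mul_ofReal] at h3
    have : Mm 0 = M 0 := by simp [hMm]
    rw [this] at h3
    rw [mul_div_assoc]
    linarith

lemma cf_contDiff {Ω : Type} [MeasurableSpace Ω] (μ : Measure Ω) [IsProbabilityMeasure μ]
    (X : Ω → ℝ) (hX : Measurable X) (k : ℕ) (hmom : Integrable (fun ω => |X ω| ^ k) μ) :
    ContDiff ℝ k (fun t : ℝ => ∫ ω, Complex.exp (Complex.I * t * X ω) ∂μ) := by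
  haveI := Measure.isProbabilityMeasure_map (μ := μ) hX.aemeasurable
  have h1 : MemLp id k (μ.map X) := by
    rw [memLp_map_measure_iff (by fun_prop) hX.aemeasurable]
    rcases Nat.eq_zero_or_pos k with rfl | hk
    · simpa using hX.aestronglyMeasurable
    · simp only [Function.id_comp]
      rw [← integrable_norm_rpow_iff hX.aestronglyMeasurable (by simpa using hk.ne') (by simp)]
      simpa using hmom
  have h2 := contDiff_charFun h1
  convert h2 using 1
  funext t
  rw [charFun_apply_real, integral_map hX.aemeasurable (by fun_prop)]
  congr 1
  funext ω
  congr 1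
  ring

/-- Theorem: smoothing inequalities for tail probabilities. If `E|X|^k < ∞`, `M ∈ Cᵏ` vanishes
outside `[-1,1]`, has even real part and odd imaginary part, and satisfies the Prawitz smoothing
inequalities for every random variable, then with `r_{T,±}(t) = M(∓t/T) f(t)` (`f` the
characteristic function of `X`), for `x ≥ 0`:
`-i^k 𝔊(Λᵏ r_{T,-})(x) ≤ x^k P(X > x) ≤ x^k P(X ≥ x) ≤ -i^k 𝔊(Λᵏ r_{T,+})(x)`
(the inequalities between a complex and a real number assert in particular that the complex
number is real). -/
theorem stmt4 (k : ℕ) (hk : 0 < k) (T x : ℝ) (hT : 0 < T) (hx : 0 ≤ x)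
    (Ω : Type) (mΩ : MeasurableSpace Ω) (μ : Measure Ω) (hμ : IsProbabilityMeasure μ)
    (X : Ω → ℝ) (hX : Measurable X)
    (hmom : Integrable (fun ω => |X ω| ^ k) μ)
    (M : ℝ → ℂ) (hMC : ContDiff ℝ k M)
    (hM0 : ∀ t : ℝ, 1 < |t| → M t = 0)
    (hMre : ∀ t : ℝ, (M (-t)).re = (M t).re)
    (hMim : ∀ t : ℝ, (M (-t)).im = -(M t).im)
    (hPraw : ∀ (Ω' : Type) (mΩ' : MeasurableSpace Ω') (ν : Measure Ω'),
      IsProbabilityMeasure ν → ∀ Y : Ω' → ℝ, Measurable Y → ∀ T' : ℝ, 0 < T' → ∀ y : ℝ,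
      ∃ Gm Gp : ℂ,
        HasG (fun t => M (-(t / T')) * ∫ ω, Complex.exp (Complex.I * t * Y ω) ∂ν) y Gm ∧
        HasG (fun t => M (t / T') * ∫ ω, Complex.exp (Complex.I * t * Y ω) ∂ν) y Gp ∧
        Gm ≤ (((ν {ω | Y ω < y}).toReal - 1 / 2 : ℝ) : ℂ) ∧
        (ν {ω | Y ω < y}).toReal ≤ (ν {ω | Y ω ≤ y}).toReal ∧
        (((ν {ω | Y ω ≤ y}).toReal - 1 / 2 : ℝ) : ℂ) ≤ Gp) :
    ∃ Gm Gp : ℂ,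
      HasG (Lam^[k] (fun t => M (t / T) * ∫ ω, Complex.exp (Complex.I * t * X ω) ∂μ)) x Gm ∧
      HasG (Lam^[k] (fun t => M (-(t / T)) * ∫ ω, Complex.exp (Complex.I * t * X ω) ∂μ)) x Gp ∧
      -(Complex.I ^ k) * Gm ≤ ((x ^ k * (μ {ω | x < X ω}).toReal : ℝ) : ℂ) ∧
      x ^ k * (μ {ω | x < X ω}).toReal ≤ x ^ k * (μ {ω | x ≤ X ω}).toReal ∧
      ((x ^ k * (μ {ω | x ≤ X ω}).toReal : ℝ) : ℂ) ≤ -(Complex.I ^ k) * Gp := by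
  
  set f : ℝ → ℂ := fun t => ∫ ω, Complex.exp (Complex.I * t * X ω) ∂μ with hf
  have hfC : ContDiff ℝ k f := cf_contDiff μ X hX k hmom
  have hf0 : f 0 = 1 := by simp [hf]
  have hM1 : ContDiff ℝ 1 M := hMC.of_le (by norm_cast)
  have him : (M 0).im = 0 := by
    have := hMim 0
    rw [neg_zero] at this
    linarith
  have hSi := M_Si M hM1 hM0 him (by
    intro y hy
    obtain ⟨Gm, Gp, h1, h2, h3, h4, h5⟩ := hPraw Unit inferInstance (Measure.dirac ())
      inferInstance (fun _ => 0) measurable_const 1 one_pos y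
    refine ⟨Gm, Gp, by simpa using h1, by simpa using h2, ?_, ?_⟩
    · have := (Complex.le_def.1 h3).1
      rw [Complex.ofReal_re] at this
      simp [hy] at this
      norm_num at this ⊢
      linarith
    · have := (Complex.le_def.1 h5).1
      rw [Complex.ofReal_re] at this
      simp [hy.le] at this
      norm_num at this ⊢
      linarith)
  have hMr : M 0 = ((M 0).re : ℂ) := by
    apply Complex.ext <;> simp [him]
  obtain ⟨Gm, Gp, h1, h2, h3, h4, h5⟩ := hPraw Ω mΩ μ hμ X hX T hT x
  -- a common value of the transform of the constant function
  obtain ⟨D, hD, hxD⟩ : ∃ D : ℂ, HasG (fun _ => M 0) x D ∧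
      ((x : ℂ) ^ k * D = (x : ℂ) ^ k * (1/2)) := by
    rcases hx.eq_or_lt with rfl | hx0
    · exact ⟨0, HasG_const_zero _, by simp [hk.ne']⟩
    · refine ⟨((1/2 : ℝ) : ℂ), ?_, by push_cast; rfl⟩
      rw [hMr]
      exact HasG_const _ x hx0 _ hSi
  have tl : ∀ r : ℝ → ℂ, (∀ t, T < |t| → r t = 0) → Tl r := fun r hr =>
    ⟨0, T, hT, fun t ht => by rw [hr t ht]; simp⟩
  have ab : ∀ t : ℝ, T < |t| → 1 < |t / T| := by
    intro t ht
    rw [abs_div, abs_of_pos hT, one_lt_div hT]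
    exact ht
  have rm := iter x k hk (fun t => M (t / T) * f t) Gp D
    ((hMC.comp (contDiff_id.div_const T)).mul hfC)
    (tl _ fun t ht => by rw [hM0 _ (ab t ht), zero_mul]) h2
    (by simpa [hf0] using hD)
  have rp := iter x k hk (fun t => M (-(t / T)) * f t) Gm D
    ((hMC.comp (contDiff_id.div_const T).neg).mul hfC)
    (tl _ fun t ht => by rw [hM0 _ (by rw [abs_neg]; exact ab t ht), zero_mul]) h1
    (by simpa [hf0] using hD)
  have calcI : ∀ G : ℂ, -(Complex.I ^ k) * ((-(Complex.I) * x) ^ k * (G - D)) =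
      ((x ^ k : ℝ) : ℂ) * (1/2 - G) := by
    intro G
    have e1 : Complex.I ^ k * (-Complex.I) ^ k = 1 := by
      rw [← mul_pow]; simp
    rw [mul_pow]
    push_cast
    linear_combination (-(x:ℂ)^k * (G - D)) * e1 + hxD
  have hxk : (0 : ℂ) ≤ ((x ^ k : ℝ) : ℂ) := by
    exact_mod_cast pow_nonneg hx k
  have m1 : (μ {ω | x < X ω}).toReal = 1 - (μ {ω | X ω ≤ x}).toReal := by
    have := probReal_compl_eq_one_sub (μ := μ) (s := {ω | X ω ≤ x})
      (measurableSet_le hX measurable_const)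
    rw [← measureReal_def, ← measureReal_def, ← this]
    congr 1
    ext ω
    simp
  have m2 : (μ {ω | x ≤ X ω}).toReal = 1 - (μ {ω | X ω < x}).toReal := by
    have := probReal_compl_eq_one_sub (μ := μ) (s := {ω | X ω < x})
      (measurableSet_lt hX measurable_const)
    rw [← measureReal_def, ← measureReal_def, ← this]
    congr 1
    ext ω
    simp
  refine ⟨_, _, rm, rp, ?_, ?_, ?_⟩
  · rw [calcI, m1, Complex.ofReal_mul]
    apply mul_le_mul_of_nonneg_left _ hxk
    have := sub_le_sub_left h5 (1/2 : ℂ)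
    refine this.trans (le_of_eq ?_)
    push_cast
    ring
  · rw [m1, m2]
    exact mul_le_mul_of_nonneg_left (by linarith) (pow_nonneg hx k)
  · rw [calcI, m2, Complex.ofReal_mul]
    apply mul_le_mul_of_nonneg_left _ hxk
    have := sub_le_sub_left h3 (1/2 : ℂ)
    refine (le_of_eq ?_).trans this
    push_cast
    ring
end

section
/- Let p be a symmetric (even) probability density function on ℝ such that ∫_{-∞}^{∞} |x|·p(x) dx < ∞, and let κ be any real number with κ ≥ 1/∫_{-∞}^{∞} |x|·p(x) dx. Let p̂(t) := ∫_{-∞}^{∞} e^{itx} p(x) dx be the Fourier transform of p and p̂' its derivative, and set M := p̂ + iκ·p̂'. Then for every random variable X with characteristic function f(t) := E e^{itX}, every real T > 0 and every real x: 𝔊(M(-·/T)·f(·))(x) ≤ P(X < x) - 1/2 ≤ P(X ≤ x) - 1/2 ≤ 𝔊(M(·/T)·f(·))(x). -/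
open MeasureTheory Filter Set
open scoped Real Topology

open scoped ComplexOrder


noncomputable def SiF (y : ℝ) : ℝ := ∫ t in (0:ℝ)..y, Real.sinc t

lemma SiF_cont : Continuous SiF :=
  intervalIntegral.continuous_primitive (fun a b => Real.continuous_sinc.intervalIntegrable a b) 0

lemma SiF_zero : SiF 0 = 0 := by simp [SiF]

lemma SiF_neg (y : ℝ) : SiF (-y) = - SiF y := by
  unfold SiF
  have := intervalIntegral.integral_comp_neg (a := 0) (b := y) Real.sinc
  simp only [Real.sinc_neg, neg_zero] at this
  rw [this, intervalIntegral.integral_symm]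

lemma inner_int (A s : ℝ) : ∫ t in (0:ℝ)..A, Real.exp (-t * s) * Real.sin t
    = (1 + s^2)⁻¹ - Real.exp (-A * s) * (Real.cos A + s * Real.sin A) * (1+s^2)⁻¹ := by
  have hs : (1 + s^2) ≠ 0 := by positivity
  rw [intervalIntegral.integral_eq_sub_of_hasDerivAt
    (f := fun t => - (Real.exp (-t * s) * (Real.cos t + s * Real.sin t) * (1+s^2)⁻¹))]
  · simp; ring
  · intro t _
    have h1 : HasDerivAt (fun t : ℝ => Real.exp (-t * s)) (Real.exp (-t*s) * (-1 * s)) t :=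
      (((hasDerivAt_id t).neg).mul_const s).exp
    have h2 : HasDerivAt (fun t : ℝ => Real.cos t + s * Real.sin t) (-Real.sin t + s * Real.cos t) t :=
      (Real.hasDerivAt_cos t).add ((Real.hasDerivAt_sin t).const_mul s)
    have h3 := ((h1.mul h2).mul_const ((1+s^2)⁻¹)).neg
    refine HasDerivAt.congr_deriv h3 ?_
    field_simp
    ring
  · apply Continuous.intervalIntegrable
    fun_prop

lemma exp_int (t : ℝ) (ht : 0 < t) : IntegrableOn (fun s => Real.exp (-t * s)) (Ioi 0) :=
  integrableOn_exp_mul_Ioi (by linarith) 0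

lemma SiF_rep (A : ℝ) (hA : 0 < A) : SiF A = π/2 -
    ∫ s in Ioi (0:ℝ), Real.exp (-A * s) * (Real.cos A + s * Real.sin A) * (1+s^2)⁻¹ := by
  have hval : ∀ t : ℝ, 0 < t → ∫ s in Ioi (0:ℝ), Real.exp (-t * s) = t⁻¹ := by
    intro t ht
    rw [integral_exp_mul_Ioi (by linarith)]
    simp [neg_div]
  have hint : Integrable (Function.uncurry (fun t s => Real.exp (-t * s) * Real.sin t))
      ((volume.restrict (Ioc 0 A)).prod (volume.restrict (Ioi 0))) := by
    rw [integrable_prod_iff]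
    · constructor
      · refine (ae_restrict_iff' measurableSet_Ioc).2 (Eventually.of_forall fun t ht => ?_)
        exact (exp_int t ht.1).mul_const (Real.sin t)
      · have : IntegrableOn (fun t => |Real.sinc t|) (Ioc 0 A) :=
          (Real.continuous_sinc.abs.intervalIntegrable 0 A).1
        refine this.congr ?_
        refine (ae_restrict_iff' measurableSet_Ioc).2 (Eventually.of_forall fun t ht => ?_)
        simp only [Function.uncurry, norm_mul, Real.norm_eq_abs, Real.abs_exp]
        rw [integral_mul_const, hval t ht.1, Real.sinc_of_ne_zero ht.1.ne', abs_div, abs_of_pos ht.1]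
        field_simp
    · apply Continuous.aestronglyMeasurable
      unfold Function.uncurry
      fun_prop
  have h1 : SiF A = ∫ t in Ioc 0 A, ∫ s in Ioi (0:ℝ), Real.exp (-t * s) * Real.sin t := by
    unfold SiF
    rw [intervalIntegral.integral_of_le hA.le]
    refine setIntegral_congr_fun measurableSet_Ioc fun t ht => ?_
    rw [integral_mul_const, hval t ht.1, Real.sinc_of_ne_zero ht.1.ne']
    field_simp
  rw [h1, integral_integral_swap hint]
  have h2 : ∀ s : ℝ, ∫ t in Ioc 0 A, Real.exp (-t * s) * Real.sin t = (1 + s^2)⁻¹ - Real.exp (-A * s) * (Real.cos A + s * Real.sin A) * (1+s^2)⁻¹ := by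
    intro s
    rw [← intervalIntegral.integral_of_le hA.le, inner_int]
  simp_rw [h2]
  have hI := hint.integral_prod_right
  simp only [Function.uncurry, h2] at hI
  have hJ : IntegrableOn (fun s : ℝ => (1+s^2)⁻¹) (Ioi 0) := integrable_inv_one_add_sq.integrableOn
  have hK := hJ.sub hI
  simp only [IntegrableOn] at hJ
  rw [integral_sub hJ]
  · rw [integral_Ioi_inv_one_add_sq]; simp
  · refine hK.congr (Eventually.of_forall fun s => ?_)
    simp

lemma SiF_bd (A : ℝ) (hA : 0 < A) : |SiF A - π/2| ≤ 2 / A := by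
  rw [SiF_rep A hA]
  have : ‖∫ s in Ioi (0:ℝ), Real.exp (-A * s) * (Real.cos A + s * Real.sin A) * (1+s^2)⁻¹‖
      ≤ ∫ s in Ioi (0:ℝ), Real.exp (-A * s) * 2 := by
    apply norm_integral_le_of_norm_le ((exp_int A hA).mul_const 2)
    refine (ae_restrict_iff' measurableSet_Ioi).2 (Eventually.of_forall fun s hs => ?_)
    have hs : 0 < s := hs
    rw [norm_mul, norm_mul, Real.norm_eq_abs, Real.abs_exp, mul_assoc]
    apply mul_le_mul_of_nonneg_left _ (Real.exp_nonneg _)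
    rw [Real.norm_eq_abs, Real.norm_eq_abs, abs_of_pos (by positivity : 0 < (1+s^2)⁻¹), ← div_eq_mul_inv,
      div_le_iff₀ (by positivity)]
    calc |Real.cos A + s * Real.sin A| ≤ |Real.cos A| + |s * Real.sin A| := abs_add_le _ _
      _ ≤ 1 + s * 1 := by
        rw [abs_mul, abs_of_pos hs]
        gcongr
        · exact Real.abs_cos_le_one A
        · exact Real.abs_sin_le_one A
      _ ≤ _ := by nlinarith [sq_nonneg (s-1)]
  rw [integral_mul_const, integral_exp_mul_Ioi (by linarith)] at this
  rw [Real.norm_eq_abs] at this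
  rw [sub_sub_cancel_left, abs_neg]
  refine this.trans (le_of_eq ?_)
  simp [neg_div]
  field_simp

lemma SiF_tendsto : Tendsto SiF atTop (𝓝 (π/2)) := by
  rw [tendsto_iff_norm_sub_tendsto_zero]
  refine squeeze_zero' (Eventually.of_forall fun _ => norm_nonneg _) ?_
    (tendsto_const_nhds.div_atTop tendsto_id : Tendsto (fun A : ℝ => 2 / A) atTop (𝓝 0))
  filter_upwards [eventually_gt_atTop 0] with A hA using SiF_bd A hA

lemma SiF_bdd (y : ℝ) : |SiF y| ≤ 4 := by
  have key : ∀ y : ℝ, 0 ≤ y → |SiF y| ≤ 4 := by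
    intro y hy
    rcases le_total y 1 with h | h
    · have := intervalIntegral.norm_integral_le_of_norm_le_const (a := 0) (b := y) (f := Real.sinc) (C := 1)
        (fun t _ => Real.abs_sinc_le_one t)
      rw [Real.norm_eq_abs] at this
      rw [sub_zero, abs_of_nonneg hy] at this
      unfold SiF
      linarith
    · have h1 := SiF_bd y (by linarith)
      have h2 : 2 / y ≤ 2 := by rw [div_le_iff₀ (by linarith)]; linarith
      have := Real.pi_lt_four
      have := Real.pi_pos
      rw [abs_le] at *
      constructor <;> linarith
  rcases le_total 0 y with h | h
  · exact key y h
  · have := key (-y) (by linarith)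
    rwa [SiF_neg, abs_neg] at this

lemma sin_int (z a b : ℝ) : ∫ t in a..b, z * Real.sinc (t * z) = SiF (b * z) - SiF (a * z) := by
  rw [intervalIntegral.integral_const_mul, intervalIntegral.mul_integral_comp_mul_right]
  unfold SiF
  rw [intervalIntegral.integral_interval_sub_left]
  · exact Real.continuous_sinc.intervalIntegrable _ _
  · exact Real.continuous_sinc.intervalIntegrable _ _

lemma sin_lim (z : ℝ) : Tendsto (fun q : ℝ × ℝ => SiF (q.2 * z) - SiF (q.1 * z))
    ((𝓝[>] (0 : ℝ)) ×ˢ atTop) (𝓝 (π / 2 * Real.sign z)) := by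
  have h1 : Tendsto (fun q : ℝ × ℝ => SiF (q.1 * z)) ((𝓝[>] (0 : ℝ)) ×ˢ atTop) (𝓝 0) := by
    have : Tendsto (fun e : ℝ => SiF (e * z)) (𝓝[>] (0 : ℝ)) (𝓝 (SiF (0 * z))) :=
      ((SiF_cont.comp (continuous_id.mul continuous_const)).tendsto 0).mono_left nhdsWithin_le_nhds
    rw [zero_mul, SiF_zero] at this
    exact this.comp tendsto_fst
  have h2 : Tendsto (fun A : ℝ => SiF (A * z)) atTop (𝓝 (π / 2 * Real.sign z)) := by
    rcases lt_trichotomy z 0 with h | h | h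
    · rw [Real.sign_of_neg h]
      have := (SiF_tendsto.comp (tendsto_id.atTop_mul_const (by linarith : 0 < -z))).neg
      simp only [Function.comp_def, ← SiF_neg, id] at this
      simpa using this
    · simp [h, SiF_zero]
    · rw [Real.sign_of_pos h, mul_one]
      exact SiF_tendsto.comp (tendsto_id.atTop_mul_const h)
  simpa using (h2.comp tendsto_snd).sub h1

lemma F_cont {S : Type*} [MeasurableSpace S] (ν : Measure S) (G Z : S → ℝ)
    (hG : Integrable G ν) (hZ : Measurable Z) :
    Continuous (fun t : ℝ => ∫ s, Complex.exp (Complex.I * t * Z s) * (G s : ℂ) ∂ν) := by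
  apply continuous_of_dominated (bound := fun s => ‖G s‖)
  · intro t
    refine AEStronglyMeasurable.mul ?_ (Complex.measurable_ofReal.comp_aemeasurable hG.aemeasurable).aestronglyMeasurable
    exact (by fun_prop : Measurable fun s => Complex.exp (Complex.I * t * Z s)).aestronglyMeasurable
  · intro t
    refine Eventually.of_forall fun s => ?_
    rw [norm_mul]
    have : Complex.I * t * Z s = ((t * Z s : ℝ) : ℂ) * Complex.I := by push_cast; ring
    rw [this, Complex.norm_exp_ofReal_mul_I, one_mul, Complex.norm_real]
  · exact hG.norm
  · refine Eventually.of_forall fun s => ?_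
    fun_prop

lemma sin_int' (z a b : ℝ) (ha : 0 < a) (hb : 0 < b) :
    ∫ t in a..b, Real.sin (t * z) / t = SiF (b * z) - SiF (a * z) := by
  rw [← sin_int]
  refine intervalIntegral.integral_congr fun t ht => ?_
  have ht0 : 0 < t := lt_of_lt_of_le (lt_min ha hb) ht.1
  by_cases hz : z = 0
  · simp [hz]
  · rw [Real.sinc_of_ne_zero (mul_ne_zero ht0.ne' hz)]
    field_simp

lemma trunc_eq {S : Type*} [MeasurableSpace S] (ν : Measure S) [SFinite ν] (G Z : S → ℝ)
    (hG : Integrable G ν) (hZ : Measurable Z) (x a b : ℝ) (ha : 0 < a) (hb : 0 < b) :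
    (Complex.I / (2 * (Real.pi : ℂ))) *
      ((∫ t in (-b)..(-a), pvI (fun t : ℝ => ∫ s, Complex.exp (Complex.I * t * Z s) * (G s : ℂ) ∂ν) x t)
       + ∫ t in a..b, pvI (fun t : ℝ => ∫ s, Complex.exp (Complex.I * t * Z s) * (G s : ℂ) ∂ν) x t)
    = ((- π⁻¹ * ∫ s, (SiF (b * (Z s - x)) - SiF (a * (Z s - x))) * G s ∂ν : ℝ) : ℂ) := by
  set F := (fun t : ℝ => ∫ s, Complex.exp (Complex.I * t * Z s) * (G s : ℂ) ∂ν) with hF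
  have hFc : Continuous F := F_cont ν G Z hG hZ
  have hpos : ∀ t ∈ uIcc a b, t ≠ 0 := fun t ht => (lt_of_lt_of_le (lt_min ha hb) ht.1).ne'
  have hc1 : ContinuousOn (fun t => pvI F x t) (uIcc a b) := by
    unfold pvI
    refine ContinuousOn.div (by fun_prop) (by fun_prop) ?_
    intro t ht
    exact_mod_cast hpos t ht
  have hc2 : ContinuousOn (fun t => pvI F x (-t)) (uIcc a b) := by
    unfold pvI
    refine ContinuousOn.div (by fun_prop) (by fun_prop) ?_
    intro t ht
    have := hpos t ht
    exact_mod_cast neg_ne_zero.2 this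
  have hint : ∀ t : ℝ, Integrable (fun s => Complex.exp (Complex.I * t * Z s) * (G s : ℂ)) ν := by
    intro t
    refine Integrable.mono' hG.norm ?_ (Eventually.of_forall fun s => ?_)
    · refine AEStronglyMeasurable.mul ?_ (Complex.measurable_ofReal.comp_aemeasurable hG.aemeasurable).aestronglyMeasurable
      exact (by fun_prop : Measurable fun s => Complex.exp (Complex.I * t * Z s)).aestronglyMeasurable
    · rw [norm_mul]
      have : Complex.I * t * Z s = ((t * Z s : ℝ) : ℂ) * Complex.I := by push_cast; ring
      rw [this, Complex.norm_exp_ofReal_mul_I, one_mul, Complex.norm_real]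
  rw [← intervalIntegral.integral_comp_neg (fun t => pvI F x t),
    ← intervalIntegral.integral_add hc2.intervalIntegrable hc1.intervalIntegrable]
  have hpt : ∀ t : ℝ, pvI F x (-t) + pvI F x t
      = 2 * Complex.I * ((∫ s, Real.sin (t * (Z s - x)) / t * G s ∂ν : ℝ) : ℂ) := by
    intro t
    unfold pvI
    have e1 : Complex.exp (-Complex.I * ((-t : ℝ) : ℂ) * x) * F (-t) / ((-t : ℝ) : ℂ)
        = ∫ s, -(Complex.exp (-Complex.I * ((-t : ℝ) : ℂ) * x) / t) * (Complex.exp (Complex.I * ((-t : ℝ) : ℂ) * Z s) * (G s : ℂ)) ∂ν := by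
      rw [integral_const_mul, hF]; push_cast; ring
    have e2 : Complex.exp (-Complex.I * t * x) * F t / t
        = ∫ s, (Complex.exp (-Complex.I * t * x) / t) * (Complex.exp (Complex.I * t * Z s) * (G s : ℂ)) ∂ν := by
      rw [integral_const_mul, hF]; ring
    rw [e1, e2, ← integral_add ((hint (-t)).const_mul _) ((hint t).const_mul _), ← integral_complex_ofReal,
      ← integral_const_mul]
    refine integral_congr_ae (Eventually.of_forall fun s => ?_)
    simp only
    push_cast
    have hs : 2 * Complex.I * Complex.sin (t * (Z s - x)) =
        Complex.exp (-Complex.I * t * x) * Complex.exp (Complex.I * t * Z s)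
        - Complex.exp (-Complex.I * (-t) * x) * Complex.exp (Complex.I * (-t) * Z s) := by
      rw [Complex.sin, ← Complex.exp_add, ← Complex.exp_add]
      have a1 : -((t:ℂ) * (Z s - x)) * Complex.I = -Complex.I * (-t) * x + Complex.I * (-t) * Z s := by ring
      have a2 : ((t:ℂ) * (Z s - x)) * Complex.I = -Complex.I * t * x + Complex.I * t * Z s := by ring
      rw [a1, a2]
      linear_combination (Complex.exp (-Complex.I * (-t) * x + Complex.I * (-t) * Z s) - Complex.exp (-Complex.I * t * x + Complex.I * t * Z s)) * Complex.I_sq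
    linear_combination (-(G s : ℂ) / t) * hs
  simp_rw [hpt]
  rw [intervalIntegral.integral_const_mul, intervalIntegral.integral_ofReal]
  rw [intervalIntegral_integral_swap]
  · have : ∀ s, ∫ t in a..b, Real.sin (t * (Z s - x)) / t * G s
        = (SiF (b * (Z s - x)) - SiF (a * (Z s - x))) * G s := by
      intro s
      rw [intervalIntegral.integral_mul_const, sin_int' _ _ _ ha hb]
    simp_rw [this]
    push_cast
    have hpi : (π : ℂ) ≠ 0 := by exact_mod_cast Real.pi_ne_zero
    generalize (∫ s, (SiF (b * (Z s - x)) - SiF (a * (Z s - x))) * G s ∂ν) = J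
    field_simp
    rw [Complex.I_sq]
    ring
  · have h1 : Integrable (fun t : ℝ => t⁻¹) (volume.restrict (uIoc a b)) := by
      rw [← IntegrableOn, ← intervalIntegrable_iff]
      exact (ContinuousOn.inv₀ continuousOn_id hpos).intervalIntegrable
    refine Integrable.mono (h1.mul_prod hG) ?_ (Eventually.of_forall fun q => ?_)
    · refine AEStronglyMeasurable.mul ?_ hG.aestronglyMeasurable.comp_snd
      exact (by fun_prop : Measurable fun q : ℝ × S => Real.sin (q.1 * (Z q.2 - x)) / q.1).aestronglyMeasurable
    · simp only [Function.uncurry, norm_mul, norm_div, norm_inv, Real.norm_eq_abs]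
      rw [div_eq_mul_inv]
      have := Real.abs_sin_le_one (q.1 * (Z q.2 - x))
      gcongr
      nlinarith [inv_nonneg.2 (abs_nonneg q.1)]

lemma hasG_gen {S : Type*} [MeasurableSpace S] (ν : Measure S) [SFinite ν] (G Z : S → ℝ)
    (hG : Integrable G ν) (hZ : Measurable Z) (x : ℝ) :
    HasG (fun t : ℝ => ∫ s, Complex.exp (Complex.I * t * Z s) * (G s : ℂ) ∂ν) x
      ((∫ s, G s * (Real.sign (x - Z s) / 2) ∂ν : ℝ) : ℂ) := by
  unfold HasG
  have hlim : Tendsto (fun q : ℝ × ℝ => ∫ s, (SiF (q.2 * (Z s - x)) - SiF (q.1 * (Z s - x))) * G s ∂ν)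
      ((𝓝[>] (0 : ℝ)) ×ˢ atTop) (𝓝 (∫ s, (π / 2 * Real.sign (Z s - x)) * G s ∂ν)) := by
    apply tendsto_integral_filter_of_dominated_convergence (fun s => 8 * ‖G s‖)
    · refine Eventually.of_forall fun q => AEStronglyMeasurable.mul ?_ hG.aestronglyMeasurable
      have := SiF_cont.measurable
      exact (by fun_prop : Measurable fun s => SiF (q.2 * (Z s - x)) - SiF (q.1 * (Z s - x))).aestronglyMeasurable
    · refine Eventually.of_forall fun q => Eventually.of_forall fun s => ?_
      rw [norm_mul]
      gcongr
      have h1 := SiF_bdd (q.2 * (Z s - x))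
      have h2 := SiF_bdd (q.1 * (Z s - x))
      rw [Real.norm_eq_abs]
      rw [abs_le] at *
      constructor <;> linarith
    · exact hG.norm.const_mul 8
    · exact Eventually.of_forall fun s => (sin_lim (Z s - x)).mul_const (G s)
  have h2 := ((Complex.continuous_ofReal.tendsto _).comp (hlim.const_mul (-π⁻¹)))
  have hval : (-π⁻¹ * ∫ s, (π / 2 * Real.sign (Z s - x)) * G s ∂ν) = ∫ s, G s * (Real.sign (x - Z s) / 2) ∂ν := by
    rw [← integral_const_mul]
    refine integral_congr_ae (Eventually.of_forall fun s => ?_)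
    have : Real.sign (x - Z s) = - Real.sign (Z s - x) := by rw [← Real.sign_neg, neg_sub]
    simp only [this]
    have := Real.pi_ne_zero
    field_simp
  rw [hval] at h2
  refine h2.congr' ?_
  have hev : ∀ᶠ q : ℝ × ℝ in (𝓝[>] (0 : ℝ)) ×ˢ atTop, 0 < q.1 ∧ 0 < q.2 := by
    have h1 : ∀ᶠ e in 𝓝[>] (0:ℝ), 0 < e := self_mem_nhdsWithin
    exact (tendsto_fst.eventually h1).and (tendsto_snd.eventually (eventually_gt_atTop (0:ℝ)))
  filter_upwards [hev] with q hq
  exact (trunc_eq ν G Z hG hZ x q.1 q.2 hq.1 hq.2).symm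

lemma sign_scale (T a : ℝ) (hT : 0 < T) : Real.sign (T * a) = Real.sign a := by
  rcases lt_trichotomy a 0 with h | h | h
  · rw [Real.sign_of_neg h, Real.sign_of_neg (mul_neg_of_pos_of_neg hT h)]
  · simp [h]
  · rw [Real.sign_of_pos h, Real.sign_of_pos (mul_pos hT h)]

lemma abs_sign_le (a : ℝ) : |Real.sign a| ≤ 1 := by
  rcases Real.sign_apply_eq a with h | h | h <;> simp [h]

lemma meas_sign : Measurable Real.sign := by
  unfold Real.sign
  exact Measurable.ite measurableSet_Iio measurable_const
    (Measurable.ite measurableSet_Ioi measurable_const measurable_const)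

section
variable (p : ℝ → ℝ) (hpmeas : Measurable p) (hppos : ∀ x : ℝ, 0 ≤ p x)
    (hpint : Integrable p (volume : Measure ℝ)) (hpone : (∫ x : ℝ, p x) = 1)
    (hpeven : ∀ x : ℝ, p (-x) = p x)
    (hxpint : Integrable (fun x : ℝ => |x| * p x) (volume : Measure ℝ))
    (κ : ℝ) (hκ : 1 / (∫ x : ℝ, |x| * p x) ≤ κ)

include hpmeas hxpint in
lemma xp_int : Integrable (fun x : ℝ => x * p x) := by
  refine hxpint.mono (by fun_prop) (Eventually.of_forall fun x => ?_)
  simp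

include hpmeas hxpint hpint in
lemma G_int : Integrable (fun u : ℝ => (1 - κ * u) * p u) := by
  refine (hpint.sub ((xp_int p hpmeas hxpint).const_mul κ)).congr (Eventually.of_forall fun x => ?_)
  simp; ring

include hppos hpone hxpint in
lemma b_pos : 0 < ∫ x : ℝ, |x| * p x := by
  have h0 : 0 ≤ ∫ x : ℝ, |x| * p x := integral_nonneg fun x => mul_nonneg (abs_nonneg _) (hppos x)
  refine lt_of_le_of_ne h0 fun h => ?_
  have h1 := (integral_eq_zero_iff_of_nonneg (fun x => mul_nonneg (abs_nonneg x) (hppos x)) hxpint).1 h.symm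
  have h2 : p =ᵐ[volume] 0 := by
    have h3 : ∀ᵐ x : ℝ, x ≠ 0 := by simp [ae_iff]
    filter_upwards [h1, h3] with x hx hx0
    simpa [hx0] using hx
  rw [integral_congr_ae h2] at hpone
  simp at hpone

include hpmeas hppos hpint hpone hpeven hxpint hκ in
lemma H_bound (w : ℝ) : (if 0 ≤ w then 1 else -1) ≤
    ∫ u : ℝ, (1 - κ * u) * p u * Real.sign (w - u) := by
  have hb := b_pos p hppos hpone hxpint
  have hκ0 : 0 < κ := lt_of_lt_of_le (by positivity) hκ
  have hκb : 1 ≤ κ * ∫ x : ℝ, |x| * p x := by rwa [div_le_iff₀ hb] at hκ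
  have hI : Integrable (fun u : ℝ => (1 - κ * u) * p u * Real.sign (w - u)) := by
    refine (G_int p hpmeas hpint hxpint κ).mono ?_ (Eventually.of_forall fun x => ?_)
    · have := meas_sign
      fun_prop
    · rw [norm_mul]
      exact mul_le_of_le_one_right (norm_nonneg _) (abs_sign_le _)
  have hI2 := hI.comp_neg
  have hsym : ∫ u : ℝ, (1 - κ * u) * p u * Real.sign (w - u)
      = ∫ u : ℝ, ((1 - κ * u) * Real.sign (w - u) + (1 + κ * u) * Real.sign (w + u)) / 2 * p u := by
    have e : ∫ u : ℝ, (1 - κ * (-u)) * p (-u) * Real.sign (w - (-u)) = ∫ u : ℝ, (1 - κ * u) * p u * Real.sign (w - u) :=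
      integral_neg_eq_self (fun u : ℝ => (1 - κ * u) * p u * Real.sign (w - u)) volume
    have e2 := integral_add hI hI2
    rw [e] at e2
    have e3 : ∫ u : ℝ, ((1 - κ * u) * Real.sign (w - u) + (1 + κ * u) * Real.sign (w + u)) / 2 * p u
       = (1/2) * ∫ u : ℝ, ((1 - κ * u) * p u * Real.sign (w - u) + (1 - κ * (-u)) * p (-u) * Real.sign (w - (-u))) := by
      rw [← integral_const_mul]
      refine integral_congr_ae (Eventually.of_forall fun u => ?_)
      simp only [hpeven, sub_neg_eq_add, mul_neg]
      ring
    rw [e3, e2]; ring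
  have hI3 : Integrable (fun u : ℝ => ((1 - κ * u) * Real.sign (w - u) + (1 + κ * u) * Real.sign (w + u)) / 2 * p u) := by
    refine ((hI.add hI2).div_const 2).congr (Eventually.of_forall fun u => ?_)
    simp only [Pi.add_apply, hpeven, sub_neg_eq_add, mul_neg]
    ring
  rw [hsym]
  split_ifs with hw
  · rcases le_total 1 (κ * w) with h | h
    · refine hpone.symm.le.trans ?_
      refine integral_mono hpint hI3 fun u => ?_
      refine le_mul_of_one_le_left (hppos u) ?_
      simp only [Real.sign]
      split_ifs <;> nlinarith
    · refine hκb.trans ?_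
      rw [← integral_const_mul]
      refine integral_mono (hxpint.const_mul κ) hI3 fun u => ?_
      simp only
      rw [← mul_assoc]
      refine mul_le_mul_of_nonneg_right ?_ (hppos u)
      simp only [Real.sign]
      rcases abs_cases u with ⟨hu, hu'⟩ | ⟨hu, hu'⟩ <;> rw [hu] <;>
      split_ifs <;> nlinarith
  · push Not at hw
    refine (by rw [integral_neg, hpone] : (-1:ℝ) = ∫ x, - p x).le.trans ?_
    refine integral_mono hpint.neg hI3 fun u => ?_
    simp only
    rw [← neg_one_mul]
    refine mul_le_mul_of_nonneg_right ?_ (hppos u)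
    simp only [Real.sign]
    split_ifs <;> nlinarith

include hpmeas hpint hxpint in
lemma M_eq (t : ℝ) : (∫ x : ℝ, Complex.exp (Complex.I * t * x) * p x)
        + Complex.I * κ * deriv (fun s : ℝ => ∫ x : ℝ, Complex.exp (Complex.I * s * x) * p x) t
    = ∫ u : ℝ, Complex.exp (Complex.I * t * u) * (((1 - κ * u) * p u : ℝ) : ℂ) := by
  have hxp := xp_int p hpmeas hxpint
  have nrm : ∀ s x : ℝ, ‖Complex.exp (Complex.I * s * x)‖ = 1 := by
    intro s x
    have : Complex.I * s * x = ((s * x : ℝ) : ℂ) * Complex.I := by push_cast; ring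
    rw [this, Complex.norm_exp_ofReal_mul_I]
  have hi1 : ∀ s : ℝ, Integrable fun x : ℝ => Complex.exp (Complex.I * s * x) * (p x : ℂ) := by
    intro s
    refine Integrable.mono' hpint.norm ?_ (Eventually.of_forall fun x => ?_)
    · exact (by fun_prop : Measurable fun x : ℝ => Complex.exp (Complex.I * s * x) * (p x : ℂ)).aestronglyMeasurable
    · rw [norm_mul, nrm, one_mul, Complex.norm_real]
  have hd := hasDerivAt_integral_of_dominated_loc_of_deriv_le (μ := volume) (𝕜 := ℝ) (x₀ := t) (s := univ)
    (F := fun (s : ℝ) (x : ℝ) => Complex.exp (Complex.I * s * x) * (p x : ℂ))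
    (F' := fun (s : ℝ) (x : ℝ) => Complex.exp (Complex.I * s * x) * (Complex.I * x) * (p x : ℂ))
    (bound := fun x => ‖x * p x‖) univ_mem
    (Eventually.of_forall fun s => (hi1 s).aestronglyMeasurable) (hi1 t)
    (by exact (by fun_prop : Measurable fun x : ℝ => Complex.exp (Complex.I * t * x) * (Complex.I * x) * (p x : ℂ)).aestronglyMeasurable)
    (Eventually.of_forall fun x s _ => by
      rw [norm_mul, norm_mul, nrm, norm_mul, norm_mul]; simp)
    hxp.norm
    (Eventually.of_forall fun x s _ => by
      have h : HasDerivAt (fun s : ℝ => Complex.I * (s : ℂ) * x) (Complex.I * 1 * x) s :=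
        ((Complex.ofRealCLM.hasDerivAt (x := s)).const_mul Complex.I).mul_const (x : ℂ)
      rw [mul_one] at h
      exact h.cexp.mul_const _)
  rw [hd.2.deriv, ← integral_const_mul, ← integral_add (hi1 t) (hd.1.const_mul _)]
  refine integral_congr_ae (Eventually.of_forall fun u => ?_)
  simp only
  push_cast
  linear_combination (κ * Complex.exp (Complex.I * t * u) * u * p u) * Complex.I_sq

end

lemma hasG_prod (g : ℝ → ℝ) (hg : Integrable g) {Ω : Type} [MeasurableSpace Ω] (μ : Measure Ω)
    [IsProbabilityMeasure μ] (X : Ω → ℝ) (hX : Measurable X) (c x : ℝ) :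
    HasG (fun t : ℝ => (∫ u : ℝ, Complex.exp (Complex.I * (c * t : ℝ) * u) * (g u : ℂ)) *
        ∫ ω, Complex.exp (Complex.I * t * X ω) ∂μ) x
      ((∫ ω, (∫ u, g u * Real.sign (x - X ω - c * u)) / 2 ∂μ : ℝ) : ℂ) ∧
    Integrable (fun ω => (∫ u, g u * Real.sign (x - X ω - c * u)) / 2) μ := by
  have hG : Integrable (fun q : ℝ × Ω => g q.1) (volume.prod μ) := hg.comp_fst μ
  have hZ : Measurable (fun q : ℝ × Ω => c * q.1 + X q.2) := by fun_prop
  have h := hasG_gen (volume.prod μ) _ _ hG hZ x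
  have hI : Integrable (fun q : ℝ × Ω => g q.1 * (Real.sign (x - (c * q.1 + X q.2)) / 2)) (volume.prod μ) := by
    refine hG.mono ?_ (Eventually.of_forall fun q => ?_)
    · refine hG.aestronglyMeasurable.mul ?_
      have := meas_sign
      exact (by fun_prop : Measurable fun q : ℝ × Ω => Real.sign (x - (c * q.1 + X q.2)) / 2).aestronglyMeasurable
    · rw [norm_mul]
      refine mul_le_of_le_one_right (norm_nonneg _) ?_
      have := abs_sign_le (x - (c * q.1 + X q.2))
      rw [norm_div, Real.norm_eq_abs, Real.norm_eq_abs, abs_of_pos (by norm_num : (0:ℝ) < 2)]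
      linarith
  have hin : ∀ ω, ∫ u, g u * (Real.sign (x - (c * u + X ω)) / 2)
      = (∫ u, g u * Real.sign (x - X ω - c * u)) / 2 := by
    intro ω
    rw [← integral_div]
    refine integral_congr_ae (Eventually.of_forall fun u => ?_)
    have : x - (c * u + X ω) = x - X ω - c * u := by ring
    simp only [this]
    ring
  constructor
  · rw [integral_prod_symm _ hI] at h
    simp only [hin] at h
    convert h using 2 with t
    rw [← integral_prod_mul]
    refine integral_congr_ae (Eventually.of_forall fun q => ?_)
    simp only
    have : Complex.exp (Complex.I * t * ((c * q.1 + X q.2 : ℝ) : ℂ)) =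
      Complex.exp (Complex.I * (c * t : ℝ) * q.1) * Complex.exp (Complex.I * t * X q.2) := by
      rw [← Complex.exp_add]; congr 1; push_cast; ring
    rw [this]; ring
  · have := hI.integral_prod_right
    simpa only [hin] using this

lemma int_ite {Ω : Type} [MeasurableSpace Ω] (μ : Measure Ω) [IsProbabilityMeasure μ] (s : Set Ω)
    (hs : MeasurableSet s) :
    Integrable (fun ω => s.indicator (fun _ => (1:ℝ)) ω - 1/2) μ ∧
      ∫ ω, (s.indicator (fun _ => (1:ℝ)) ω - 1/2) ∂μ = (μ s).toReal - 1/2 := by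
  have h : Integrable (s.indicator (fun _ => (1:ℝ))) μ := (integrable_const 1).indicator hs
  refine ⟨h.sub (integrable_const _), ?_⟩
  rw [integral_sub h (integrable_const _), integral_indicator hs]
  simp [Measure.real]


/-- Proposition (Bohman): let `p` be a symmetric probability density with `∫|x|p(x)dx < ∞`, and
`κ ≥ 1/∫|x|p(x)dx`. With `p̂(t) = ∫ e^{itx} p(x) dx` and `M = p̂ + iκ p̂'`, for every random
variable `X` with characteristic function `f`, every `T > 0` and every real `x`, the smoothing
inequalities hold:
`𝔊(M(-·/T) f(·))(x) ≤ P(X < x) - 1/2 ≤ P(X ≤ x) - 1/2 ≤ 𝔊(M(·/T) f(·))(x)`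
(in particular the principal-value integrals exist and are real). -/
theorem stmt11 (p : ℝ → ℝ) (hpmeas : Measurable p) (hppos : ∀ x : ℝ, 0 ≤ p x)
    (hpint : Integrable p (volume : Measure ℝ)) (hpone : (∫ x : ℝ, p x) = 1)
    (hpeven : ∀ x : ℝ, p (-x) = p x)
    (hxpint : Integrable (fun x : ℝ => |x| * p x) (volume : Measure ℝ))
    (κ : ℝ) (hκ : 1 / (∫ x : ℝ, |x| * p x) ≤ κ)
    (M : ℝ → ℂ)
    (hM : ∀ t : ℝ, M t
      = (∫ x : ℝ, Complex.exp (Complex.I * t * x) * p x)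
        + Complex.I * κ * deriv (fun s : ℝ => ∫ x : ℝ, Complex.exp (Complex.I * s * x) * p x) t) :
    ∀ (Ω : Type) (mΩ : MeasurableSpace Ω) (μ : Measure Ω), IsProbabilityMeasure μ →
    ∀ X : Ω → ℝ, Measurable X → ∀ T : ℝ, 0 < T → ∀ x : ℝ,
    ∃ Gm Gp : ℂ,
      HasG (fun t => M (-(t / T)) * ∫ ω, Complex.exp (Complex.I * t * X ω) ∂μ) x Gm ∧
      HasG (fun t => M (t / T) * ∫ ω, Complex.exp (Complex.I * t * X ω) ∂μ) x Gp ∧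
      Gm ≤ (((μ {ω | X ω < x}).toReal - 1 / 2 : ℝ) : ℂ) ∧
      (μ {ω | X ω < x}).toReal ≤ (μ {ω | X ω ≤ x}).toReal ∧
      (((μ {ω | X ω ≤ x}).toReal - 1 / 2 : ℝ) : ℂ) ≤ Gp := by
  intro Ω mΩ μ hμ X hX T hT x
  have hgi := G_int p hpmeas hpint hxpint κ
  have hH := H_bound p hpmeas hppos hpint hpone hpeven hxpint κ hκ
  have hMt : ∀ t : ℝ, M t = ∫ u : ℝ, Complex.exp (Complex.I * t * u) * (((1 - κ * u) * p u : ℝ) : ℂ) :=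
    fun t => (hM t).trans (M_eq p hpmeas hpint hxpint κ t)
  obtain ⟨hm, hmi⟩ := hasG_prod _ hgi μ X hX (-T⁻¹) x
  obtain ⟨hp, hpi⟩ := hasG_prod _ hgi μ X hX (T⁻¹) x
  refine ⟨((∫ ω, (∫ u, (1 - κ * u) * p u * Real.sign (x - X ω - -T⁻¹ * u)) / 2 ∂μ : ℝ) : ℂ),
    ((∫ ω, (∫ u, (1 - κ * u) * p u * Real.sign (x - X ω - T⁻¹ * u)) / 2 ∂μ : ℝ) : ℂ),
    ?_, ?_, ?_, ?_, ?_⟩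
  · convert hm using 2 with t
    rw [hMt]
    have : -(t / T) = -T⁻¹ * t := by ring
    rw [this]
  · convert hp using 2 with t
    rw [hMt]
    have : t / T = T⁻¹ * t := by ring
    rw [this]
  · rw [Complex.real_le_real]
    obtain ⟨h1, h2⟩ := int_ite μ {ω | X ω < x} (measurableSet_lt hX measurable_const)
    rw [← h2]
    refine integral_mono hmi h1 fun ω => ?_
    have e : ∫ u, (1 - κ * u) * p u * Real.sign (x - X ω - -T⁻¹ * u)
        = - ∫ u, (1 - κ * u) * p u * Real.sign (T * (X ω - x) - u) := by
      rw [← integral_neg]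
      refine integral_congr_ae (Eventually.of_forall fun u => ?_)
      have : x - X ω - -T⁻¹ * u = T⁻¹ * -(T * (X ω - x) - u) := by field_simp; ring
      simp only [this]
      rw [sign_scale _ _ (inv_pos.2 hT), Real.sign_neg]
      ring
    have h3 := hH (T * (X ω - x))
    simp only [e, indicator, mem_ofPred_eq]
    by_cases h : X ω < x
    · rw [if_neg (by nlinarith)] at h3
      rw [if_pos h]; linarith
    · rw [if_pos (by nlinarith)] at h3
      rw [if_neg h]; linarith
  · refine ENNReal.toReal_mono (measure_ne_top _ _) (measure_mono fun ω hω => ?_)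
    simp only [mem_ofPred_eq] at hω ⊢
    exact le_of_lt hω
  · rw [Complex.real_le_real]
    obtain ⟨h1, h2⟩ := int_ite μ {ω | X ω ≤ x} (measurableSet_le hX measurable_const)
    rw [← h2]
    refine integral_mono h1 hpi fun ω => ?_
    have e : ∫ u, (1 - κ * u) * p u * Real.sign (x - X ω - T⁻¹ * u)
        = ∫ u, (1 - κ * u) * p u * Real.sign (T * (x - X ω) - u) := by
      refine integral_congr_ae (Eventually.of_forall fun u => ?_)
      have : x - X ω - T⁻¹ * u = T⁻¹ * (T * (x - X ω) - u) := by field_simp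
      simp only [this]
      rw [sign_scale _ _ (inv_pos.2 hT)]
    have h3 := hH (T * (x - X ω))
    simp only [e, indicator, mem_ofPred_eq]
    by_cases h : X ω ≤ x
    · rw [if_pos (by nlinarith)] at h3
      rw [if_pos h]; linarith
    · rw [if_neg (by nlinarith)] at h3
      rw [if_neg h]; linarith
end
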